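/- For every ε > 0 and every φ ∈ K, one has ∫_ℝ ‖(G − (ε − iτ))⁻¹ φ‖² dτ ≤ π M² ε⁻¹ ‖φ‖². (Here ε − iτ has positive real part, so it lies in the resolvent set of G and ‖(G − (ε − iτ))⁻¹‖ ≤ M/ε.) -/

import Mathlib

open MeasureTheory FourierTransform Filter Topology Set
open scoped ContDiff

theorem plancherel_aux {K : Type*} [NormedAddCommGroup K] [InnerProductSpace ℂ K]
    [CompleteSpace K] (f : ℝ → K) (h1 : Integrable f) (h2 : MemLp f 2) :
    ∫ w : ℝ, ‖𝓕 f w‖ ^ 2 = ∫ t : ℝ, ‖f t‖ ^ 2 := by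
  have hcont : Continuous (𝓕 f) :=
    VectorFourier.fourierIntegral_continuous Real.continuous_fourierChar
      (innerSL ℝ).continuous₂ h1
  set F : Lp K 2 (volume : Measure ℝ) := h2.toLp f with hF
  have hFf : ∀ᵐ x : ℝ, F x = f x := h2.coeFn_toLp
  have key : ∀ᵐ x : ℝ, 𝓕 f x = (𝓕 F : Lp K 2 (volume : Measure ℝ)) x := by
    apply ae_eq_of_integral_contDiff_smul_eq
    · exact hcont.locallyIntegrable
    · exact (Lp.memLp _).locallyIntegrable (by norm_num)
    · intro g g_smooth g_cpt
      have hg₁ : HasCompactSupport (Complex.ofRealCLM ∘ g) := g_cpt.comp_left rfl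
      have hg₂ : ContDiff ℝ ∞ (Complex.ofRealCLM ∘ g) := by fun_prop
      set G := hg₁.toSchwartzMap hg₂ with hG
      have e1 : ∫ x, g x • (𝓕 F : Lp K 2 (volume : Measure ℝ)) x
          = Lp.toTemperedDistribution (𝓕 F : Lp K 2 (volume : Measure ℝ)) G := by
        simp [hG]
      rw [e1, ← Lp.fourier_toTemperedDistribution_eq, TemperedDistribution.fourier_apply,
        Lp.toTemperedDistribution_apply]
      have e2 := VectorFourier.integral_fourierIntegral_smul_eq_flip (μ := volume) (ν := volume)
        (f := (G : ℝ → ℂ)) (g := f) (L := innerₗ ℝ) Real.continuous_fourierChar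
        (innerSL ℝ).continuous₂ G.integrable h1
      rw [flip_innerₗ] at e2
      calc ∫ x, g x • 𝓕 f x = ∫ x, G x • 𝓕 f x := by simp [hG]
        _ = ∫ x, (𝓕 G) x • f x := by
          rw [SchwartzMap.fourier_coe]; exact e2.symm
        _ = _ := by
          apply integral_congr_ae
          filter_upwards [hFf] with x hx
          rw [hx]
  have n1 : ∀ u : Lp K 2 (volume : Measure ℝ), ∫ x, ‖u x‖ ^ 2 = ‖u‖ ^ 2 := by
    intro u
    have := congrArg Complex.re (L2.inner_def (𝕜 := ℂ) u u)
    rw [inner_self_eq_norm_sq_to_K] at this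
    have h3 : ∫ a, inner ℂ (u a) (u a) = ((∫ x, ‖u x‖ ^ 2 : ℝ) : ℂ) := by
      refine Eq.trans ?_ (integral_ofReal (𝕜 := ℂ))
      congr 1
      ext a
      rw [inner_self_eq_norm_sq_to_K]
      simp
    rw [h3] at this
    norm_cast at this
    exact this.symm
  calc ∫ w : ℝ, ‖𝓕 f w‖ ^ 2 = ∫ w, ‖(𝓕 F : Lp K 2 (volume : Measure ℝ)) w‖ ^ 2 := by
        apply integral_congr_ae
        filter_upwards [key] with x hx
        rw [hx]
    _ = ‖F‖ ^ 2 := by rw [n1, Lp.norm_fourier_eq]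
    _ = _ := by
        rw [← n1]
        apply integral_congr_ae
        filter_upwards [hFf] with x hx
        rw [hx]

/-- Plancherel estimate for the resolvent. Let `G` generate a bounded
`C₀`-semigroup `S` on a Hilbert space `K` with `sup ‖S t‖ ≤ M`. For `ε > 0` the point
`ε - iτ` is in the resolvent set of `G`; denoting `Rz ε τ = (G - (ε - iτ))⁻¹`, one has
`∫_ℝ ‖Rz ε τ φ‖² dτ ≤ π M² ε⁻¹ ‖φ‖²`. -/
theorem resolvent_L2_bound
    {K : Type*} [NormedAddCommGroup K] [InnerProductSpace ℂ K] [CompleteSpace K]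
    (dom : Submodule ℂ K) (hdense : Dense (dom : Set K))
    (G : dom →ₗ[ℂ] K)
    -- the semigroup
    (S : ℝ → K →L[ℂ] K)
    (hS0 : S 0 = 1)
    (hSadd : ∀ t s : ℝ, 0 ≤ t → 0 ≤ s → S (t + s) = S t ∘L S s)
    (hScont : ∀ φ : K, ContinuousOn (fun t => S t φ) (Set.Ici (0:ℝ)))
    -- `G` is its infinitesimal generator
    (hSdom : ∀ φ : dom, ∀ t : ℝ, 0 ≤ t → S t (φ : K) ∈ dom)
    (hSderiv : ∀ φ : dom, ∀ t : ℝ, 0 ≤ t →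
      HasDerivWithinAt (fun s : ℝ => S s (φ : K)) (S t (G φ)) (Set.Ici (0:ℝ)) t)
    (hgen : ∀ φ : K, (∃ ψ : K, HasDerivWithinAt (fun s : ℝ => S s φ) ψ (Set.Ici (0:ℝ)) 0)
      → φ ∈ dom)
    -- boundedness of the semigroup
    (M : ℝ) (hM : ∀ t : ℝ, 0 ≤ t → ‖S t‖ ≤ M)
    -- `Rz ε τ = (G - (ε - iτ))⁻¹` for `ε > 0`
    (Rz : ℝ → ℝ → (K →L[ℂ] K))
    (hRmem : ∀ (ε τ : ℝ), 0 < ε → ∀ φ : K, Rz ε τ φ ∈ dom)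
    (hRright : ∀ (ε τ : ℝ) (hε : 0 < ε) (φ : K),
      G ⟨Rz ε τ φ, hRmem ε τ hε φ⟩ - ((ε : ℂ) - Complex.I * (τ : ℂ)) • Rz ε τ φ = φ)
    (hRleft : ∀ (ε τ : ℝ), 0 < ε → ∀ φ : dom,
      Rz ε τ (G φ - ((ε : ℂ) - Complex.I * (τ : ℂ)) • (φ : K)) = φ) :
    ∀ (ε : ℝ), 0 < ε → ∀ φ : K,
      (∫ τ : ℝ, ‖Rz ε τ φ‖ ^ 2) ≤ Real.pi * M ^ 2 / ε * ‖φ‖ ^ 2 := by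
  intro ε hε φ
  have hM0 : 0 ≤ M := (norm_nonneg _).trans (hM 0 le_rfl)
  set C : ℝ := M * ‖φ‖ with hC
  have hC0 : 0 ≤ C := by positivity
  have hSb : ∀ t, 0 ≤ t → ∀ ψ : K, ‖S t ψ‖ ≤ M * ‖ψ‖ := fun t ht ψ =>
    (S t).le_of_opNorm_le (hM t ht) ψ
  set f : ℝ → K := (Ioi (0:ℝ)).indicator (fun t => Real.exp (-ε * t) • S t φ) with hf
  have hmeas : AEStronglyMeasurable f volume := by
    rw [hf, aestronglyMeasurable_indicator_iff measurableSet_Ioi]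
    apply ContinuousOn.aestronglyMeasurable _ measurableSet_Ioi
    exact (by fun_prop : Continuous fun t : ℝ => Real.exp (-ε * t)).continuousOn.smul
      ((hScont φ).mono Ioi_subset_Ici_self)
  have hbd : ∀ t, ‖f t‖ ≤ (Ioi (0:ℝ)).indicator (fun t => C * Real.exp (-ε * t)) t := by
    intro t
    rw [hf, norm_indicator_eq_indicator_norm]
    apply indicator_le_indicator'
    intro ht
    rw [norm_smul, Real.norm_of_nonneg (Real.exp_nonneg _), mul_comm]
    exact mul_le_mul_of_nonneg_right (hSb t (le_of_lt ht) φ) (Real.exp_nonneg _)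
  have hbd2 : ∀ t, ‖f t‖ ^ 2 ≤
      (Ioi (0:ℝ)).indicator (fun t => C ^ 2 * Real.exp (-(2 * ε) * t)) t := by
    intro t
    refine (pow_le_pow_left₀ (norm_nonneg _) (hbd t) 2).trans (le_of_eq ?_)
    by_cases ht : t ∈ Ioi (0:ℝ)
    · simp only [indicator_of_mem ht]
      rw [mul_pow, ← Real.exp_nat_mul]
      congr 2
      push_cast
      ring
    · simp only [indicator_of_notMem ht]
      norm_num
  have hexp : ∀ a : ℝ, 0 < a → ∀ c : ℝ,
      Integrable ((Ioi (0:ℝ)).indicator (fun t => c * Real.exp (-a * t))) := by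
    intro a ha c
    rw [integrable_indicator_iff measurableSet_Ioi]
    exact (exp_neg_integrableOn_Ioi 0 ha).const_mul c
  have h1 : Integrable f :=
    (hexp ε hε C).mono' hmeas (Eventually.of_forall hbd)
  have hsq : Integrable (fun t => ‖f t‖ ^ 2) := by
    refine (hexp (2 * ε) (by positivity) (C ^ 2)).mono' (hmeas.norm.pow 2)
      (Eventually.of_forall fun t => ?_)
    rw [Real.norm_of_nonneg (by positivity)]
    exact hbd2 t
  have h2 : MemLp f 2 := (memLp_two_iff_integrable_sq_norm hmeas).2 hsq
  have hfint : ∫ t, ‖f t‖ ^ 2 ≤ C ^ 2 / (2 * ε) := by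
    refine (integral_mono hsq (hexp (2 * ε) (by positivity) (C ^ 2)) hbd2).trans (le_of_eq ?_)
    rw [integral_indicator measurableSet_Ioi, integral_const_mul,
      integral_exp_mul_Ioi (by linarith) 0]
    simp
    field_simp
  -- the resolvent as a Laplace transform
  have hres : ∀ τ : ℝ, Rz ε τ φ = - 𝓕 f (τ * (-(2 * Real.pi)⁻¹)) := by
    intro τ
    set lam : ℂ := (ε : ℂ) - Complex.I * (τ : ℂ) with hlam
    set ψ : dom := ⟨Rz ε τ φ, hRmem ε τ hε φ⟩ with hψ
    have hG : G ψ - lam • (ψ : K) = φ := hRright ε τ hε φ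
    have hnorm : ∀ t : ℝ, ‖Complex.exp (-lam * t)‖ = Real.exp (-ε * t) := by
      intro t
      rw [Complex.norm_exp]
      simp [hlam]
    have hexpd : ∀ t : ℝ, HasDerivAt (fun s : ℝ => Complex.exp (-lam * s))
        (Complex.exp (-lam * t) * (-lam)) t := by
      intro t
      have := ((hasDerivAt_id (t : ℂ)).const_mul (-lam)).cexp.comp_ofReal
      simpa using this
    have hder : ∀ t ∈ Ioi (0:ℝ), HasDerivAt (fun s : ℝ => Complex.exp (-lam * s) • S s (ψ : K))
        (Complex.exp (-lam * t) • S t φ) t := by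
      intro t ht
      have hs := (hSderiv ψ t (le_of_lt ht)).hasDerivAt (Ici_mem_nhds ht)
      have := (hexpd t).smul hs
      refine this.congr_deriv ?_
      rw [← hG, map_sub, map_smul, smul_sub, smul_smul, mul_neg, neg_smul]
      abel
    have hfe : ∀ t : ℝ, (Ioi (0:ℝ)).indicator (fun t : ℝ => Complex.exp (-lam * t) • S t φ) t
        = Complex.exp ((↑(-2 * Real.pi * t * (τ * (-(2 * Real.pi)⁻¹))) * Complex.I)) • f t := by
      intro t
      by_cases ht : t ∈ Ioi (0:ℝ)
      · rw [hf]
        simp only [indicator_of_mem ht]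
        rw [← Complex.coe_smul, smul_smul, Complex.ofReal_exp, ← Complex.exp_add]
        congr 2
        have : -2 * Real.pi * t * (τ * (-(2 * Real.pi)⁻¹)) = τ * t := by
          field_simp
        rw [this, hlam]
        push_cast
        ring
      · rw [hf]
        simp only [indicator_of_notMem ht, smul_zero]
    have hint : IntegrableOn (fun t : ℝ => Complex.exp (-lam * t) • S t φ) (Ioi 0) := by
      rw [← integrable_indicator_iff measurableSet_Ioi]
      rw [funext hfe]
      refine h1.bdd_smul (C := 1) ?_ ?_
      · exact (by fun_prop : Continuous _).aestronglyMeasurable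
      · refine Eventually.of_forall fun t => ?_
        rw [Complex.norm_exp_ofReal_mul_I]
    have hlim : Tendsto (fun s : ℝ => Complex.exp (-lam * s) • S s (ψ : K)) atTop (𝓝 0) := by
      have hz : Tendsto (fun s : ℝ => Real.exp (-ε * s) * (M * ‖(ψ : K)‖)) atTop (𝓝 0) := by
        have : Tendsto (fun s : ℝ => Real.exp (-ε * s)) atTop (𝓝 0) :=
          Real.tendsto_exp_atBot.comp (tendsto_id.const_mul_atTop_of_neg (by linarith))
        simpa using this.mul_const (M * ‖(ψ : K)‖)
      refine squeeze_zero_norm' ?_ hz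
      filter_upwards [eventually_ge_atTop (0:ℝ)] with s hs
      rw [norm_smul, hnorm]
      exact mul_le_mul_of_nonneg_left (hSb s hs _) (Real.exp_nonneg _)
    have hc0 : ContinuousWithinAt (fun s : ℝ => Complex.exp (-lam * s) • S s (ψ : K)) (Ici 0) 0 :=
      (hexpd 0).continuousAt.continuousWithinAt.smul ((hScont ψ) 0 self_mem_Ici)
    have hI := integral_Ioi_of_hasDerivAt_of_tendsto hc0 hder hint hlim
    rw [← integral_indicator measurableSet_Ioi, funext hfe,
      ← Real.fourier_real_eq_integral_exp_smul] at hI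
    rw [hI]
    simp [hS0, hψ]
  have hfin : ∫ τ : ℝ, ‖Rz ε τ φ‖ ^ 2 = 2 * Real.pi * ∫ t, ‖f t‖ ^ 2 := by
    simp_rw [hres, norm_neg]
    rw [Measure.integral_comp_mul_right (fun w => ‖𝓕 f w‖ ^ 2), plancherel_aux f h1 h2]
    rw [inv_neg, inv_inv, abs_neg, abs_of_pos (by positivity), smul_eq_mul]
  rw [hfin]
  calc 2 * Real.pi * ∫ t, ‖f t‖ ^ 2 ≤ 2 * Real.pi * (C ^ 2 / (2 * ε)) := by gcongr
    _ = _ := by rw [hC]; field_simp
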